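/- Let g be a polynomial over a field K in variables Y_1,…,Y_m and let 0 ≤ k ≤ m. Then Σ_{e ∈ {0,1}^m with exactly k ones} g(e_1,…,e_m) = Σ_{ℓ=0}^{k} C(m−ℓ, k−ℓ) · spc_ℓ(g)(1,…,1), where C(·,·) denotes the binomial coefficient. -/

import Mathlib

open MvPolynomial

/-- `spc k g`: the sum of the monomials of `g` whose support has size exactly `k`. -/
noncomputable def spc {K : Type*} [Field K] {m : ℕ} (k : ℕ)
    (g : MvPolynomial (Fin m) K) : MvPolynomial (Fin m) K :=
  ∑ d ∈ g.support.filter (fun d => d.support.card = k), monomial d (coeff d g)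

theorem count_aux {m k : ℕ} (S : Finset (Fin m)) (hS : S.card ≤ k) :
    ((Finset.univ.filter (fun e : Fin m → Bool =>
      (Finset.univ.filter fun i => e i = true).card = k)).filter
      (fun e => ∀ i ∈ S, e i = true)).card = (m - S.card).choose (k - S.card) := by
  have h : (Finset.powersetCard (k - S.card) Sᶜ).card = (m - S.card).choose (k - S.card) := by
    rw [Finset.card_powersetCard, Finset.card_compl, Fintype.card_fin]
  rw [← h]
  refine Finset.card_bij' (fun e _ => (Finset.univ.filter fun i => e i = true) \ S)
    (fun T _ => fun i => decide (i ∈ T ∪ S)) ?_ ?_ ?_ ?_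
  · intro e he
    simp only [Finset.mem_filter, Finset.mem_univ, true_and] at he
    rw [Finset.mem_powersetCard]
    refine ⟨?_, ?_⟩
    · intro i hi
      simp at hi ⊢
      exact hi.2
    · rw [Finset.card_sdiff_of_subset, he.1]
      intro i hi
      simpa using he.2 i hi
  · intro T hT
    rw [Finset.mem_powersetCard] at hT
    have hd : Disjoint T S := by
      rw [Finset.disjoint_left]
      intro i hi
      simpa using hT.1 hi
    have h2 : (Finset.univ.filter fun i => decide (i ∈ T ∪ S) = true) = T ∪ S := by
      ext i; simp
    simp only [Finset.mem_filter, Finset.mem_univ, true_and]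
    refine ⟨?_, ?_⟩
    · rw [h2, Finset.card_union_of_disjoint hd, hT.2]; omega
    · intro i hi; simp [hi]
  · intro e he
    simp only [Finset.mem_filter, Finset.mem_univ, true_and] at he
    funext i
    by_cases hi : i ∈ S
    · simp [hi, he.2 i hi]
    · simp [hi]
  · intro T hT
    rw [Finset.mem_powersetCard] at hT
    ext i
    have := @hT.1 i
    simp only [Finset.mem_compl] at this
    simp
    tauto

/-- `∑_{e ∈ {0,1}^m, exactly k ones} g(e) = ∑_{ℓ=0}^{k} C(m-ℓ, k-ℓ) spc_ℓ(g)(1,…,1)`. -/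
theorem stmt_7 {K : Type*} [Field K] {m : ℕ} (g : MvPolynomial (Fin m) K)
    (k : ℕ) (hk : k ≤ m) :
    ∑ e ∈ Finset.univ.filter
        (fun e : Fin m → Bool => (Finset.univ.filter fun i => e i = true).card = k),
      eval (fun i => if e i then (1 : K) else 0) g
      = ∑ ℓ ∈ Finset.range (k + 1),
          ((m - ℓ).choose (k - ℓ) : K) * eval (fun _ => (1 : K)) (spc ℓ g) := by
  have hev : ∀ e : Fin m → Bool, eval (fun i => if e i then (1 : K) else 0) g
      = ∑ d ∈ g.support, if ∀ i ∈ d.support, e i = true then coeff d g else 0 := by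
    intro e
    rw [eval_eq]
    refine Finset.sum_congr rfl fun d _ => ?_
    split_ifs with h
    · rw [Finset.prod_eq_one, mul_one]
      intro i hi
      simp [h i hi]
    · push Not at h
      obtain ⟨i, hi, hi2⟩ := h
      rw [Finset.prod_eq_zero hi, mul_zero]
      have : d i ≠ 0 := by simpa using hi
      simp [hi2, this]
  have hspc : ∀ l, eval (fun _ => (1 : K)) (spc l g)
      = ∑ d ∈ g.support, if d.support.card = l then coeff d g else 0 := by
    intro l
    rw [spc, map_sum, Finset.sum_filter]
    refine Finset.sum_congr rfl fun d _ => ?_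
    simp [eval_monomial]
  simp_rw [hev, hspc, Finset.mul_sum]
  rw [Finset.sum_comm, Finset.sum_comm (s := Finset.range (k + 1))]
  refine Finset.sum_congr rfl fun d _ => ?_
  rw [← Finset.sum_filter, Finset.sum_const, nsmul_eq_mul]
  simp_rw [mul_ite, mul_zero]
  rw [Finset.sum_ite_eq]
  split_ifs with h
  · rw [count_aux _ (by simpa [Nat.lt_succ_iff] using h)]
  · rw [Finset.card_eq_zero.mpr, Nat.cast_zero, zero_mul]
    rw [Finset.filter_eq_empty_iff]
    intro e he hc
    simp only [Finset.mem_filter, Finset.mem_univ, true_and] at he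
    apply h
    rw [Finset.mem_range, Nat.lt_succ_iff, ← he]
    apply Finset.card_le_card
    intro i hi
    simpa using hc i hi
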